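/- There exists a constant C depending only on d and n, and independent of t₀, such that for every t₀ ∈ ℝ the ℓ⁴ norm of the kernel-weighted oscillatory sum decays: ‖𝔉^{Ker}(·,t₀)‖_{ℓ⁴} = ( ∑_{m∈ℤ^d} |𝔉^{Ker}(m,t₀)|⁴ )^{1/4} ≤ C·⟨t₀⟩^{−(2n/7 + 13/30)}. -/

import Mathlib

open MeasureTheory

/-- The lattice dispersion relation `ω_∞(ξ) = sin ξ₁ · (sin² ξ₁ + ⋯ + sin² ξ_d)`. -/
noncomputable def omegaInf {d : ℕ} [NeZero d] (ξ : Fin d → ℝ) : ℝ :=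
  Real.sin (ξ 0) * ∑ j, Real.sin (ξ j) ^ 2

/-- The kernel-weighted oscillatory sum
`𝔉^{Ker}(m,t₀) = ∫_{[−π,π]^d} |sin ξ₁|^n e^{i m·ξ} e^{i t₀ ω_∞(ξ)} dξ`. -/
noncomputable def FKer {d : ℕ} [NeZero d] (n : ℕ) (t₀ : ℝ) (m : Fin d → ℤ) : ℂ :=
  ∫ ξ in Set.univ.pi fun _ : Fin d => Set.Icc (-Real.pi) Real.pi,
    ((|Real.sin (ξ 0)| ^ n : ℝ) : ℂ) *
      Complex.exp (Complex.I * ((∑ j, (m j : ℝ) * ξ j : ℝ) : ℂ)) *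
      Complex.exp (Complex.I * ((t₀ * omegaInf ξ : ℝ) : ℂ))

/-- Powers of `|sin|` with exponent above `-1` are integrable on bounded intervals. -/
theorem intervalIntegrable_abs_sin_rpow {r : ℝ} (hr : -1 < r) (a b : ℝ) :
    IntervalIntegrable (fun x => |Real.sin x| ^ r) volume a b := by
  rcases le_or_gt 0 r with h0 | h0
  · exact (Real.continuous_sin.abs.rpow_const fun x => Or.inr h0).intervalIntegrable _ _
  have hpi := Real.pi_pos
  have hmeas : Measurable fun x : ℝ => |Real.sin x| ^ r := by fun_prop
  have key : IntervalIntegrable (fun x => |Real.sin x| ^ r) volume 0 (Real.pi / 2) := by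
    refine ((intervalIntegral.intervalIntegrable_rpow' (a := 0) (b := Real.pi / 2) hr).const_mul
      ((2 / Real.pi) ^ r)).mono_fun' hmeas.aestronglyMeasurable ?_
    refine (ae_restrict_iff' measurableSet_uIoc).2 (Filter.Eventually.of_forall fun x hx => ?_)
    rw [Set.uIoc_of_le (by positivity)] at hx
    have h1 := Real.mul_abs_le_abs_sin (x := x) (by rw [abs_of_pos hx.1]; exact hx.2)
    rw [abs_of_pos hx.1] at h1
    have h2 : 0 < 2 / Real.pi * x := mul_pos (by positivity) hx.1
    simp only
    rw [Real.norm_of_nonneg (by positivity), ← Real.mul_rpow (by positivity) hx.1.le]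
    exact Real.rpow_le_rpow_of_nonpos h2 h1 h0.le
  have key2 : IntervalIntegrable (fun x => |Real.sin x| ^ r) volume (-(Real.pi / 2)) 0 := by
    have := (IntervalIntegrable.iff_comp_neg (f := fun x => |Real.sin x| ^ r)).1 key
    simpa using this.symm
  refine Function.Periodic.intervalIntegrable (T := Real.pi) (t := -(Real.pi / 2)) ?_ hpi.ne' ?_ a b
  · intro x
    simp
  · have : -(Real.pi / 2) + Real.pi = Real.pi / 2 := by ring
    rw [this]
    exact key2.trans key

theorem intervalIntegrable_abs_cos_two_mul_rpow {r : ℝ} (hr : -1 < r) (a b : ℝ) :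
    IntervalIntegrable (fun x => |Real.cos (2 * x)| ^ r) volume a b := by
  have h := ((intervalIntegrable_abs_sin_rpow hr (2 * a + Real.pi / 2)
    (2 * b + Real.pi / 2)).comp_add_right (Real.pi / 2)).comp_mul_left (c := 2)
  simpa [Real.sin_add_pi_div_two] using h

theorem ae_sin_ne_zero : ∀ᵐ x : ℝ, Real.sin x ≠ 0 := by
  have h : {x : ℝ | Real.sin x = 0} = Set.range fun n : ℤ => (n : ℝ) * Real.pi := by
    ext x
    simp [Real.sin_eq_zero_iff]
  rw [ae_iff]
  simpa [h] using (Set.countable_range fun n : ℤ => (n : ℝ) * Real.pi).measure_zero volume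

theorem ae_cos_two_mul_ne_zero : ∀ᵐ x : ℝ, Real.cos (2 * x) ≠ 0 := by
  have h : {x : ℝ | Real.cos (2 * x) = 0} ⊆
      Set.range fun n : ℤ => (2 * (n : ℝ) + 1) * Real.pi / 4 := by
    intro x hx
    obtain ⟨k, hk⟩ := Real.cos_eq_zero_iff.1 hx
    exact ⟨k, by simp only; linarith⟩
  rw [ae_iff]
  simpa using measure_mono_null h ((Set.countable_range _).measure_zero volume)

/-- The derivative of the phase `m x + L sin² x`. -/
noncomputable def phaseDeriv (m : ℤ) (L x : ℝ) : ℝ := m + L * Real.sin (2 * x)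

theorem continuous_phaseDeriv (m : ℤ) (L : ℝ) : Continuous (phaseDeriv m L) := by
  unfold phaseDeriv; fun_prop

theorem hasDerivAt_phaseDeriv (m : ℤ) (L x : ℝ) :
    HasDerivAt (phaseDeriv m L) (2 * L * Real.cos (2 * x)) x := by
  have h : HasDerivAt (fun y : ℝ => 2 * y) 2 x := by
    simpa using (hasDerivAt_id x).const_mul 2
  exact (((h.sin).const_mul L).const_add (m : ℝ)).congr_deriv (by ring)

theorem hasDerivAt_phase (m : ℤ) (L x : ℝ) :
    HasDerivAt (fun y => (m : ℝ) * y + L * Real.sin y ^ 2) (phaseDeriv m L x) x := by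
  refine (((hasDerivAt_id x).const_mul (m : ℝ)).add
    (((Real.hasDerivAt_sin x).pow 2).const_mul L)).congr_deriv ?_
  rw [phaseDeriv, Real.sin_two_mul]
  push_cast
  ring

theorem integral_abs_deriv_phaseDeriv_le_of_sign (m : ℤ) {L ρ a b σ : ℝ} (hρ : 0 < ρ)
    (hab : a ≤ b) (hσ : |σ| = 1) (h : ∀ x ∈ Set.Icc a b, 0 ≤ σ * (L * Real.cos (2 * x))) :
    ∫ x in a..b, |2 * L * Real.cos (2 * x)| / (ρ ^ 2 + phaseDeriv m L x ^ 2) ≤ Real.pi / ρ := by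
  have hd : ∀ x, HasDerivAt (fun x => σ / ρ * Real.arctan (phaseDeriv m L x / ρ))
      (σ * (2 * L * Real.cos (2 * x)) / (ρ ^ 2 + phaseDeriv m L x ^ 2)) x := by
    intro x
    refine ((((hasDerivAt_phaseDeriv m L x).div_const ρ).arctan).const_mul (σ / ρ)).congr_deriv ?_
    have : 0 < ρ ^ 2 + phaseDeriv m L x ^ 2 := by positivity
    field_simp
  have hc : Continuous fun x =>
      σ * (2 * L * Real.cos (2 * x)) / (ρ ^ 2 + phaseDeriv m L x ^ 2) := by
    have := continuous_phaseDeriv m L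
    refine Continuous.div (by fun_prop) (by fun_prop) fun x => by positivity
  have he : ∫ x in a..b, |2 * L * Real.cos (2 * x)| / (ρ ^ 2 + phaseDeriv m L x ^ 2) =
      ∫ x in a..b, σ * (2 * L * Real.cos (2 * x)) / (ρ ^ 2 + phaseDeriv m L x ^ 2) := by
    refine intervalIntegral.integral_congr fun x hx => ?_
    rw [Set.uIcc_of_le hab] at hx
    have h1 := h x hx
    have h2 : |2 * L * Real.cos (2 * x)| = σ * (2 * L * Real.cos (2 * x)) := by
      have h3 : 0 ≤ σ * (2 * L * Real.cos (2 * x)) := by linarith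
      rw [← abs_of_nonneg h3, abs_mul σ, hσ, one_mul]
    simp only [h2]
  rw [he, intervalIntegral.integral_eq_sub_of_hasDerivAt (fun x _ => hd x)
    (hc.intervalIntegrable _ _), ← mul_sub]
  have h1 := Real.arctan_lt_pi_div_two (phaseDeriv m L b / ρ)
  have h2 := Real.arctan_lt_pi_div_two (phaseDeriv m L a / ρ)
  have h3 := Real.neg_pi_div_two_lt_arctan (phaseDeriv m L b / ρ)
  have h4 := Real.neg_pi_div_two_lt_arctan (phaseDeriv m L a / ρ)
  refine (le_abs_self _).trans ?_
  rw [abs_mul, abs_div, hσ, abs_of_pos hρ, one_div, div_eq_inv_mul Real.pi]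
  refine mul_le_mul_of_nonneg_left ?_ (by positivity)
  rw [abs_le]
  constructor <;> linarith

theorem integral_abs_deriv_phaseDeriv_le (m : ℤ) (L : ℝ) {ρ : ℝ} (hρ : 0 < ρ) :
    ∫ x in -Real.pi..Real.pi, |2 * L * Real.cos (2 * x)| / (ρ ^ 2 + phaseDeriv m L x ^ 2) ≤
      5 * Real.pi / ρ := by
  have hpi := Real.pi_pos
  have hc : Continuous fun x =>
      |2 * L * Real.cos (2 * x)| / (ρ ^ 2 + phaseDeriv m L x ^ 2) := by
    have := continuous_phaseDeriv m L
    refine Continuous.div (by fun_prop) (by fun_prop) fun x => by positivity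
  have hi := fun a b : ℝ => hc.intervalIntegrable (μ := volume) a b
  obtain ⟨τ, hτ, hτL⟩ : ∃ τ : ℝ, |τ| = 1 ∧ 0 ≤ τ * L := by
    rcases le_total 0 L with h | h
    · exact ⟨1, by simp, by simpa⟩
    · exact ⟨-1, by simp, by simpa⟩
  have hpos : ∀ k : ℤ, ∀ a b : ℝ, a ≤ b → -(Real.pi / 4) ≤ a + k * Real.pi →
      b + k * Real.pi ≤ Real.pi / 4 →
      ∫ x in a..b, |2 * L * Real.cos (2 * x)| / (ρ ^ 2 + phaseDeriv m L x ^ 2) ≤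
        Real.pi / ρ := by
    intro k a b hab ha hb
    refine integral_abs_deriv_phaseDeriv_le_of_sign m hρ hab hτ fun x hx => ?_
    have h1 : 0 ≤ Real.cos (2 * x + k * (2 * Real.pi)) :=
      Real.cos_nonneg_of_mem_Icc ⟨by linarith [hx.1], by linarith [hx.2]⟩
    rw [Real.cos_add_int_mul_two_pi] at h1
    rw [← mul_assoc]
    exact mul_nonneg hτL h1
  have hneg : ∀ k : ℤ, ∀ a b : ℝ, a ≤ b → Real.pi / 4 ≤ a + k * Real.pi →
      b + k * Real.pi ≤ 3 * Real.pi / 4 →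
      ∫ x in a..b, |2 * L * Real.cos (2 * x)| / (ρ ^ 2 + phaseDeriv m L x ^ 2) ≤
        Real.pi / ρ := by
    intro k a b hab ha hb
    refine integral_abs_deriv_phaseDeriv_le_of_sign m hρ hab (σ := -τ) (by simpa) fun x hx => ?_
    have h1 : Real.cos (2 * x + k * (2 * Real.pi)) ≤ 0 :=
      Real.cos_nonpos_of_pi_div_two_le_of_le (by linarith [hx.1]) (by linarith [hx.2])
    rw [Real.cos_add_int_mul_two_pi] at h1
    have := mul_nonneg hτL (neg_nonneg.2 h1)
    linarith
  have p1 := hpos 1 (-Real.pi) (-(3 * Real.pi / 4)) (by linarith) (by push_cast; linarith)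
    (by push_cast; linarith)
  have p2 := hneg 1 (-(3 * Real.pi / 4)) (-(Real.pi / 4)) (by linarith) (by push_cast; linarith)
    (by push_cast; linarith)
  have p3 := hpos 0 (-(Real.pi / 4)) (Real.pi / 4) (by linarith) (by push_cast; linarith)
    (by push_cast; linarith)
  have p4 := hneg 0 (Real.pi / 4) (3 * Real.pi / 4) (by linarith) (by push_cast; linarith)
    (by push_cast; linarith)
  have p5 := hpos (-1) (3 * Real.pi / 4) Real.pi (by linarith) (by push_cast; linarith)
    (by push_cast; linarith)
  rw [← intervalIntegral.integral_add_adjacent_intervals (hi _ (-(3 * Real.pi / 4))) (hi _ _),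
    ← intervalIntegral.integral_add_adjacent_intervals (hi _ (-(Real.pi / 4))) (hi _ Real.pi),
    ← intervalIntegral.integral_add_adjacent_intervals (hi _ (Real.pi / 4)) (hi _ Real.pi),
    ← intervalIntegral.integral_add_adjacent_intervals (hi _ (3 * Real.pi / 4)) (hi _ Real.pi)]
  have : 5 * Real.pi / ρ = Real.pi / ρ + (Real.pi / ρ + (Real.pi / ρ + (Real.pi / ρ +
    Real.pi / ρ))) := by ring
  linarith

/-- The one-dimensional oscillatory integral `∫_{-π}^{π} e^{i (m x + L sin² x)} dx`. -/
noncomputable def oscIntegral (m : ℤ) (L : ℝ) : ℂ :=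
  ∫ x in -Real.pi..Real.pi, Complex.exp (Complex.I * (((m : ℝ) * x + L * Real.sin x ^ 2 : ℝ) : ℂ))

theorem norm_oscIntegral_le_two_pi (m : ℤ) (L : ℝ) : ‖oscIntegral m L‖ ≤ 2 * Real.pi := by
  have hpi := Real.pi_pos
  refine (intervalIntegral.norm_integral_le_of_norm_le_const (C := 1) fun x _ => ?_).trans ?_
  · rw [mul_comm, Complex.norm_exp_ofReal_mul_I]
  · rw [abs_of_pos (by linarith)]
    linarith

theorem exp_phase_pi (m : ℤ) (L : ℝ) :
    Complex.exp (Complex.I * (((m : ℝ) * Real.pi + L * Real.sin Real.pi ^ 2 : ℝ) : ℂ)) =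
      Complex.exp (Complex.I *
        (((m : ℝ) * (-Real.pi) + L * Real.sin (-Real.pi) ^ 2 : ℝ) : ℂ)) := by
  rw [Complex.exp_eq_exp_iff_exists_int]
  refine ⟨m, ?_⟩
  simp
  ring

theorem norm_oscIntegral_le_integral (m : ℤ) (L : ℝ) {ρ : ℝ} (hρ : 0 < ρ) :
    ‖oscIntegral m L‖ ≤ ∫ x in -Real.pi..Real.pi,
      (ρ ^ 2 / (ρ ^ 2 + phaseDeriv m L x ^ 2) +
        |2 * L * Real.cos (2 * x)| / (ρ ^ 2 + phaseDeriv m L x ^ 2)) := by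
  have hpi := Real.pi_pos
  have hu := continuous_phaseDeriv m L
  have hpos : ∀ x, 0 < ρ ^ 2 + phaseDeriv m L x ^ 2 := fun x => by positivity
  set e : ℝ → ℂ := fun x =>
    Complex.exp (Complex.I * (((m : ℝ) * x + L * Real.sin x ^ 2 : ℝ) : ℂ)) with he
  have hec : Continuous e := by rw [he]; fun_prop
  have hnorm : ∀ x, ‖e x‖ = 1 := fun x => by
    rw [he]; simp only; rw [mul_comm, Complex.norm_exp_ofReal_mul_I]
  set w' : ℝ → ℝ := fun x => 2 * L * Real.cos (2 * x) * (ρ ^ 2 - phaseDeriv m L x ^ 2) /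
    (ρ ^ 2 + phaseDeriv m L x ^ 2) ^ 2 with hw'
  have hw'c : Continuous w' :=
    Continuous.div (by fun_prop) (by fun_prop) fun x => (pow_pos (hpos x) 2).ne'
  set w : ℝ → ℝ := fun x => phaseDeriv m L x / (ρ ^ 2 + phaseDeriv m L x ^ 2) with hw
  have hwc : Continuous w := Continuous.div (by fun_prop) (by fun_prop) fun x => (hpos x).ne'
  have hwd : ∀ x, HasDerivAt w (w' x) x := by
    intro x
    have h1 := hasDerivAt_phaseDeriv m L x
    refine (h1.div ((h1.pow 2).const_add (ρ ^ 2)) (hpos x).ne').congr_deriv ?_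
    rw [hw']
    simp only [Pi.pow_apply]
    congr 1
    push_cast
    ring
  have hed : ∀ x, HasDerivAt e (e x * (Complex.I * (phaseDeriv m L x : ℂ))) x := fun x =>
    ((hasDerivAt_phase m L x).ofReal_comp.const_mul Complex.I).cexp
  have hGd : ∀ x, HasDerivAt (fun x => e x * (w x : ℂ))
      (e x * (Complex.I * (phaseDeriv m L x : ℂ)) * (w x : ℂ) + e x * (w' x : ℂ)) x :=
    fun x => (hed x).mul (hwd x).ofReal_comp
  have hG0 : ∫ x in -Real.pi..Real.pi,
      (e x * (Complex.I * (phaseDeriv m L x : ℂ)) * (w x : ℂ) + e x * (w' x : ℂ)) = 0 := by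
    rw [intervalIntegral.integral_eq_sub_of_hasDerivAt (fun x _ => hGd x)
      (Continuous.intervalIntegrable (by fun_prop) _ _)]
    have h1 : e Real.pi = e (-Real.pi) := exp_phase_pi m L
    have h2 : w Real.pi = w (-Real.pi) := by
      simp [hw, phaseDeriv]
    rw [h1, h2, sub_self]
  have hJ : oscIntegral m L = ∫ x in -Real.pi..Real.pi,
      (e x + Complex.I *
        (e x * (Complex.I * (phaseDeriv m L x : ℂ)) * (w x : ℂ) + e x * (w' x : ℂ))) := by
    rw [intervalIntegral.integral_add (hec.intervalIntegrable _ _)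
      (Continuous.intervalIntegrable (by fun_prop) _ _), intervalIntegral.integral_const_mul, hG0,
      mul_zero, add_zero]
    rfl
  rw [hJ]
  refine (intervalIntegral.norm_integral_le_integral_norm (by linarith)).trans ?_
  have hc1 : Continuous fun x => ρ ^ 2 / (ρ ^ 2 + phaseDeriv m L x ^ 2) +
        |2 * L * Real.cos (2 * x)| / (ρ ^ 2 + phaseDeriv m L x ^ 2) :=
    (Continuous.div (by fun_prop) (by fun_prop) fun x => (hpos x).ne').add
      (Continuous.div (by fun_prop) (by fun_prop) fun x => (hpos x).ne')
  refine intervalIntegral.integral_mono_on (by linarith)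
    (Continuous.intervalIntegrable (by fun_prop) _ _) (hc1.intervalIntegrable _ _) fun x _ => ?_
  have hx := hpos x
  have hsplit : e x + Complex.I *
        (e x * (Complex.I * (phaseDeriv m L x : ℂ)) * (w x : ℂ) + e x * (w' x : ℂ)) =
      e x * ((ρ ^ 2 / (ρ ^ 2 + phaseDeriv m L x ^ 2) : ℝ) : ℂ) +
        e x * (Complex.I * (w' x : ℂ)) := by
    have h1 : ρ ^ 2 / (ρ ^ 2 + phaseDeriv m L x ^ 2) = 1 - phaseDeriv m L x * w x := by
      rw [hw]
      field_simp
      ring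
    rw [h1]
    push_cast
    linear_combination (e x * phaseDeriv m L x * w x) * Complex.I_sq
  rw [hsplit]
  refine (norm_add_le _ _).trans ?_
  rw [norm_mul, norm_mul, norm_mul, hnorm, Complex.norm_I, one_mul, one_mul, one_mul,
    Complex.norm_real, Complex.norm_real, Real.norm_of_nonneg (by positivity), Real.norm_eq_abs]
  refine add_le_add le_rfl ?_
  rw [hw']
  simp only
  rw [abs_div, abs_mul _ (ρ ^ 2 - _), abs_of_pos (pow_pos hx 2), div_le_div_iff₀ (pow_pos hx 2) hx]
  have h2 : |ρ ^ 2 - phaseDeriv m L x ^ 2| ≤ ρ ^ 2 + phaseDeriv m L x ^ 2 := by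
    rw [abs_le]
    constructor <;> nlinarith [sq_nonneg ρ, sq_nonneg (phaseDeriv m L x)]
  have h3 := mul_le_mul_of_nonneg_left (mul_le_mul_of_nonneg_right h2 hx.le)
    (abs_nonneg (2 * L * Real.cos (2 * x)))
  linarith

theorem exists_norm_oscIntegral_le : ∃ A : ℝ, 0 < A ∧ ∀ (m : ℤ) (L : ℝ), L ≠ 0 →
    ‖oscIntegral m L‖ ≤ A * |L| ^ (-(2 / 7 : ℝ)) := by
  have hpi := Real.pi_pos
  set B := ∫ x in -Real.pi..Real.pi, |Real.cos (2 * x)| ^ (-(2 / 3) : ℝ) with hB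
  have hB0 : 0 ≤ B := intervalIntegral.integral_nonneg (by linarith) fun x _ => by positivity
  refine ⟨B + 8 * Real.pi, by positivity, fun m L hL => ?_⟩
  have hl : 0 < |L| := abs_pos.2 hL
  set l := |L| with hl_def
  set ρ := l ^ (2 / 7 : ℝ) with hρ_def
  set ε := l ^ (-(3 / 7) : ℝ) with hε_def
  have hρ : 0 < ρ := Real.rpow_pos_of_pos hl _
  have hε : 0 < ε := Real.rpow_pos_of_pos hl _
  have hu := continuous_phaseDeriv m L
  have hpos : ∀ x, 0 < ρ ^ 2 + phaseDeriv m L x ^ 2 := fun x => by positivity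
  have hρε : ρ ^ 2 = l * ε := by
    rw [hρ_def, hε_def, ← Real.rpow_natCast, ← Real.rpow_mul hl.le, ← Real.rpow_one_add' hl.le]
      <;> norm_num
  have hε23 : ε ^ (2 / 3 : ℝ) = l ^ (-(2 / 7) : ℝ) := by
    rw [hε_def, ← Real.rpow_mul hl.le]; norm_num
  have hρinv : ρ⁻¹ = l ^ (-(2 / 7) : ℝ) := by
    rw [hρ_def, Real.rpow_neg hl.le]
  have hc0 : Continuous fun x =>
      |2 * L * Real.cos (2 * x)| / (ρ ^ 2 + phaseDeriv m L x ^ 2) :=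
    Continuous.div (by fun_prop) (by fun_prop) fun x => (hpos x).ne'
  have hc1 : Continuous fun x => ρ ^ 2 / (ρ ^ 2 + phaseDeriv m L x ^ 2) +
        |2 * L * Real.cos (2 * x)| / (ρ ^ 2 + phaseDeriv m L x ^ 2) :=
    (Continuous.div (by fun_prop) (by fun_prop) fun x => (hpos x).ne').add hc0
  have hint1 := (intervalIntegrable_abs_cos_two_mul_rpow (r := -(2 / 3)) (by norm_num)
    (-Real.pi) Real.pi).const_mul (ε ^ (2 / 3 : ℝ))
  have hint2 := (hc0.intervalIntegrable (μ := volume) (-Real.pi) Real.pi).const_mul (3 / 2)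
  have hae : (fun x => ρ ^ 2 / (ρ ^ 2 + phaseDeriv m L x ^ 2) +
        |2 * L * Real.cos (2 * x)| / (ρ ^ 2 + phaseDeriv m L x ^ 2)) ≤ᵐ[volume]
      fun x => ε ^ (2 / 3 : ℝ) * |Real.cos (2 * x)| ^ (-(2 / 3) : ℝ) +
        3 / 2 * (|2 * L * Real.cos (2 * x)| / (ρ ^ 2 + phaseDeriv m L x ^ 2)) := by
    filter_upwards [ae_cos_two_mul_ne_zero] with x hx
    have hc : 0 < |Real.cos (2 * x)| := abs_pos.2 hx
    set c := |Real.cos (2 * x)|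
    have habs : |2 * L * Real.cos (2 * x)| = 2 * l * c := by
      rw [abs_mul, abs_mul, abs_two]
    have hp := hpos x
    rw [habs]
    suffices h : ρ ^ 2 / (ρ ^ 2 + phaseDeriv m L x ^ 2) ≤
        ε ^ (2 / 3 : ℝ) * c ^ (-(2 / 3) : ℝ) + l * c / (ρ ^ 2 + phaseDeriv m L x ^ 2) by
      have h3 : 2 * l * c / (ρ ^ 2 + phaseDeriv m L x ^ 2) =
        2 * (l * c / (ρ ^ 2 + phaseDeriv m L x ^ 2)) := by ring
      rw [h3]; linarith
    rcases le_total c ε with h | h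
    · have h1 : 1 ≤ ε ^ (2 / 3 : ℝ) * c ^ (-(2 / 3) : ℝ) := by
        rw [Real.rpow_neg hc.le, ← div_eq_mul_inv, one_le_div (by positivity)]
        gcongr
      have h2 : ρ ^ 2 / (ρ ^ 2 + phaseDeriv m L x ^ 2) ≤ 1 := by
        rw [div_le_one hp]; nlinarith [sq_nonneg (phaseDeriv m L x)]
      have h3 : 0 ≤ l * c / (ρ ^ 2 + phaseDeriv m L x ^ 2) := by positivity
      linarith
    · have h1 : 0 ≤ ε ^ (2 / 3 : ℝ) * c ^ (-(2 / 3) : ℝ) := by positivity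
      have h2 : ρ ^ 2 / (ρ ^ 2 + phaseDeriv m L x ^ 2) ≤
          l * c / (ρ ^ 2 + phaseDeriv m L x ^ 2) := by
        apply div_le_div_of_nonneg_right _ hp.le
        rw [hρε]
        gcongr
      linarith
  have h1 := norm_oscIntegral_le_integral m L hρ
  have h2 := intervalIntegral.integral_mono_ae (by linarith) (hc1.intervalIntegrable _ _)
    (hint1.add hint2) hae
  rw [intervalIntegral.integral_add hint1 hint2, intervalIntegral.integral_const_mul,
    intervalIntegral.integral_const_mul, ← hB, hε23] at h2
  have h3 := integral_abs_deriv_phaseDeriv_le m L hρ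
  rw [div_eq_mul_inv, hρinv] at h3
  have h4 : 0 < l ^ (-(2 / 7) : ℝ) := by positivity
  nlinarith [mul_pos hpi h4]

/-- The decay rate `2/7` and the trivial bound interpolate to every rate in `[0, 2/7]`. -/
theorem exists_norm_oscIntegral_le_rpow : ∃ A : ℝ, 0 < A ∧ ∀ (m : ℤ) (L b : ℝ), L ≠ 0 →
    0 ≤ b → b ≤ 2 / 7 → ‖oscIntegral m L‖ ≤ A * |L| ^ (-b) := by
  obtain ⟨A, hA, h⟩ := exists_norm_oscIntegral_le
  have hpi := Real.pi_pos
  refine ⟨A + 2 * Real.pi, by positivity, fun m L b hL hb hb' => ?_⟩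
  have hl : 0 < |L| := abs_pos.2 hL
  rcases le_total |L| 1 with h1 | h1
  · have : 1 ≤ |L| ^ (-b) := Real.one_le_rpow_of_pos_of_le_one_of_nonpos hl h1 (by linarith)
    have := norm_oscIntegral_le_two_pi m L
    nlinarith
  · have h2 : |L| ^ (-(2 / 7 : ℝ)) ≤ |L| ^ (-b) :=
      Real.rpow_le_rpow_of_exponent_le h1 (by linarith)
    have h3 := h m L hL
    have h4 : 0 < |L| ^ (-b) := by positivity
    nlinarith [mul_pos hpi h4]

theorem integral_exp_int_mul (k : ℤ) :
    ∫ x in Set.Icc (-Real.pi) Real.pi, Complex.exp (Complex.I * (((k : ℝ) * x : ℝ) : ℂ)) =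
      if k = 0 then 2 * (Real.pi : ℂ) else 0 := by
  have hpi := Real.pi_pos
  rw [integral_Icc_eq_integral_Ioc, ← intervalIntegral.integral_of_le (by linarith)]
  split_ifs with hk
  · simp [hk]
    ring
  · have hc : Complex.I * (k : ℂ) ≠ 0 := mul_ne_zero Complex.I_ne_zero (by exact_mod_cast hk)
    have h1 : ∀ x : ℝ, Complex.exp (Complex.I * (((k : ℝ) * x : ℝ) : ℂ)) =
        Complex.exp (Complex.I * (k : ℂ) * (x : ℂ)) := fun x => by push_cast; ring_nf
    simp_rw [h1]
    rw [integral_exp_mul_complex hc]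
    have h2 : Complex.exp (Complex.I * (k : ℂ) * (Real.pi : ℂ)) =
        Complex.exp (Complex.I * (k : ℂ) * ((-Real.pi : ℝ) : ℂ)) := by
      rw [Complex.exp_eq_exp_iff_exists_int]
      exact ⟨k, by push_cast; ring⟩
    rw [h2, sub_self, zero_div]

theorem restrict_cube_eq_pi (d : ℕ) :
    (volume : Measure (Fin d → ℝ)).restrict
        (Set.univ.pi fun _ : Fin d => Set.Icc (-Real.pi) Real.pi) =
      Measure.pi fun _ : Fin d => (volume : Measure ℝ).restrict (Set.Icc (-Real.pi) Real.pi) := by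
  rw [volume_pi, Measure.restrict_pi_pi]

/-- The lattice exponential `ξ ↦ e^{-i m·ξ}`. -/
noncomputable def latticeExp {d : ℕ} (m : Fin d → ℤ) (ξ : Fin d → ℝ) : ℂ :=
  Complex.exp (-(Complex.I * ((∑ j, (m j : ℝ) * ξ j : ℝ) : ℂ)))

theorem continuous_latticeExp {d : ℕ} (m : Fin d → ℤ) : Continuous (latticeExp m) := by
  unfold latticeExp; fun_prop

theorem conj_latticeExp {d : ℕ} (m : Fin d → ℤ) (ξ : Fin d → ℝ) :
    (starRingEnd ℂ) (latticeExp m ξ) =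
      Complex.exp (Complex.I * ((∑ j, (m j : ℝ) * ξ j : ℝ) : ℂ)) := by
  rw [latticeExp, ← Complex.exp_conj, map_neg, map_mul, Complex.conj_I, Complex.conj_ofReal]
  ring_nf

theorem norm_latticeExp {d : ℕ} (m : Fin d → ℤ) (ξ : Fin d → ℝ) : ‖latticeExp m ξ‖ = 1 := by
  rw [← Complex.norm_conj, conj_latticeExp, mul_comm, Complex.norm_exp_ofReal_mul_I]

theorem integral_conj_latticeExp_mul {d : ℕ} (m m' : Fin d → ℤ) :
    ∫ ξ in Set.univ.pi fun _ : Fin d => Set.Icc (-Real.pi) Real.pi,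
      (starRingEnd ℂ) (latticeExp m ξ) * latticeExp m' ξ =
        if m = m' then (2 * (Real.pi : ℂ)) ^ d else 0 := by
  have h : ∀ ξ : Fin d → ℝ, (starRingEnd ℂ) (latticeExp m ξ) * latticeExp m' ξ =
      ∏ j, Complex.exp (Complex.I * ((((m j - m' j : ℤ) : ℝ) * ξ j : ℝ) : ℂ)) := by
    intro ξ
    rw [conj_latticeExp, latticeExp, ← Complex.exp_add, ← Complex.exp_sum]
    congr 1
    push_cast
    rw [← mul_neg, ← mul_add, ← Finset.mul_sum, ← sub_eq_add_neg, ← Finset.sum_sub_distrib]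
    simp only [sub_mul]
  simp_rw [h]
  rw [restrict_cube_eq_pi, integral_fintype_prod_eq_prod (𝕜 := ℂ)
    (fun j x => Complex.exp (Complex.I * ((((m j - m' j : ℤ) : ℝ) * x : ℝ) : ℂ)))]
  simp_rw [integral_exp_int_mul, sub_eq_zero]
  split_ifs with hm
  · simp [hm]
  · obtain ⟨j, hj⟩ := Function.ne_iff.1 hm
    exact Finset.prod_eq_zero (Finset.mem_univ j) (if_neg hj)

/-- The weight and time-dependent phase in the integrand of `FKer`. -/
noncomputable def kernelSymbol {d : ℕ} [NeZero d] (n : ℕ) (t₀ : ℝ) (ξ : Fin d → ℝ) : ℂ :=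
  ((|Real.sin (ξ 0)| ^ n : ℝ) : ℂ) * Complex.exp (Complex.I * ((t₀ * omegaInf ξ : ℝ) : ℂ))

theorem continuous_kernelSymbol {d : ℕ} [NeZero d] (n : ℕ) (t₀ : ℝ) :
    Continuous (kernelSymbol (d := d) n t₀) := by
  unfold kernelSymbol omegaInf; fun_prop

theorem norm_kernelSymbol_le {d : ℕ} [NeZero d] (n : ℕ) (t₀ : ℝ) (ξ : Fin d → ℝ) :
    ‖kernelSymbol n t₀ ξ‖ ≤ 1 := by
  rw [kernelSymbol, norm_mul, mul_comm Complex.I, Complex.norm_exp_ofReal_mul_I, mul_one,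
    Complex.norm_real, Real.norm_of_nonneg (by positivity)]
  exact pow_le_one₀ (abs_nonneg _) (Real.abs_sin_le_one _)

theorem FKer_eq_integral_conj_latticeExp {d : ℕ} [NeZero d] (n : ℕ) (t₀ : ℝ) (m : Fin d → ℤ) :
    FKer n t₀ m = ∫ ξ in Set.univ.pi fun _ : Fin d => Set.Icc (-Real.pi) Real.pi,
      (starRingEnd ℂ) (latticeExp m ξ) * kernelSymbol n t₀ ξ := by
  rw [FKer]
  congr 1 with ξ
  rw [conj_latticeExp, kernelSymbol]
  ring

/-- Bessel's inequality for the kernel, uniformly in time. -/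
theorem exists_tsum_norm_FKer_sq_le (d n : ℕ) [NeZero d] : ∃ D : ℝ, 0 < D ∧ ∀ t₀ : ℝ,
    Summable (fun m : Fin d → ℤ => ‖FKer (d := d) n t₀ m‖ ^ 2) ∧
      ∑' m : Fin d → ℤ, ‖FKer (d := d) n t₀ m‖ ^ 2 ≤ D := by
  have hpi := Real.pi_pos
  set ν := (volume : Measure (Fin d → ℝ)).restrict
    (Set.univ.pi fun _ : Fin d => Set.Icc (-Real.pi) Real.pi) with hν
  have : IsFiniteMeasure ν := by
    rw [hν, restrict_cube_eq_pi]; infer_instance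
  set P : ℝ := (2 * Real.pi) ^ d with hP
  have hP0 : 0 < P := by positivity
  set c : ℝ := (Real.sqrt P)⁻¹ with hc
  have hc2 : c * c * P = 1 := by
    rw [hc, ← mul_inv, Real.mul_self_sqrt hP0.le, inv_mul_cancel₀ hP0.ne']
  have hc0 : 0 < c := by positivity
  have hmem : ∀ m : Fin d → ℤ, MemLp (fun ξ => (c : ℂ) * latticeExp m ξ) 2 ν := fun m =>
    MemLp.of_bound (continuous_const.mul (continuous_latticeExp m)).aestronglyMeasurable c
      (Filter.Eventually.of_forall fun ξ => by
        rw [norm_mul, norm_latticeExp, mul_one, Complex.norm_real, Real.norm_of_nonneg hc0.le])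
  have hgmem : ∀ t₀ : ℝ, MemLp (kernelSymbol (d := d) n t₀) 2 ν := fun t₀ =>
    MemLp.of_bound (continuous_kernelSymbol n t₀).aestronglyMeasurable 1
      (Filter.Eventually.of_forall fun ξ => norm_kernelSymbol_le n t₀ ξ)
  have hinner : ∀ (f g : (Fin d → ℝ) → ℂ) (hf : MemLp f 2 ν) (hg : MemLp g 2 ν),
      inner ℂ (hf.toLp f) (hg.toLp g) = ∫ ξ, (starRingEnd ℂ) (f ξ) * g ξ ∂ν := by
    intro f g hf hg
    rw [L2.inner_def]
    refine integral_congr_ae ?_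
    filter_upwards [hf.coeFn_toLp, hg.coeFn_toLp] with ξ h1 h2
    rw [h1, h2, RCLike.inner_apply, mul_comm]
  have horth : Orthonormal ℂ (fun m => (hmem m).toLp _) := by
    classical
    rw [orthonormal_iff_ite]
    intro m m'
    rw [hinner]
    have h1 : ∀ ξ, (starRingEnd ℂ) ((c : ℂ) * latticeExp m ξ) * ((c : ℂ) * latticeExp m' ξ) =
        ((c * c : ℝ) : ℂ) * ((starRingEnd ℂ) (latticeExp m ξ) * latticeExp m' ξ) := by
      intro ξ
      rw [map_mul, Complex.conj_ofReal]
      push_cast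
      ring
    simp_rw [h1]
    rw [integral_const_mul, hν, integral_conj_latticeExp_mul]
    split_ifs
    · have : ((c * c * P : ℝ) : ℂ) = 1 := by rw [hc2]; simp
      rw [← this, hP]
      push_cast
      ring
    · simp
  have hcoef : ∀ t₀ (m : Fin d → ℤ), ‖inner ℂ ((hmem m).toLp _) ((hgmem t₀).toLp _)‖ ^ 2 =
      c ^ 2 * ‖FKer (d := d) n t₀ m‖ ^ 2 := by
    intro t₀ m
    rw [hinner, FKer_eq_integral_conj_latticeExp, ← hν]
    simp_rw [map_mul, Complex.conj_ofReal, mul_assoc]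
    rw [integral_const_mul, norm_mul, Complex.norm_real, Real.norm_of_nonneg hc0.le, mul_pow]
  obtain ⟨M, hM⟩ : ∃ M : ℝ, ∀ t₀, ‖(hgmem t₀).toLp (kernelSymbol (d := d) n t₀)‖ ≤ M := by
    refine ⟨_, fun t₀ => Lp.norm_le_of_ae_bound zero_le_one ?_⟩
    filter_upwards [(hgmem t₀).coeFn_toLp] with ξ h1
    rw [h1]
    exact norm_kernelSymbol_le n t₀ ξ
  refine ⟨P * M ^ 2 + 1, by positivity, fun t₀ => ?_⟩
  have hs := horth.inner_products_summable ((hgmem t₀).toLp _)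
  have hle := horth.tsum_inner_products_le ((hgmem t₀).toLp _)
  simp_rw [hcoef] at hs hle
  have hs' := (summable_mul_left_iff (pow_pos hc0 2).ne').1 hs
  refine ⟨hs', ?_⟩
  rw [tsum_mul_left] at hle
  have h1 := hle.trans (pow_le_pow_left₀ (norm_nonneg _) (hM t₀) 2)
  have h2 := mul_le_mul_of_nonneg_left h1 hP0.le
  rw [← mul_assoc] at h2
  have h3 : P * c ^ 2 = 1 := by rw [← hc2]; ring
  rw [h3, one_mul] at h2
  linarith

theorem exists_norm_FKer_le_rpow (N n : ℕ) [NeZero (N + 1)] {a : ℝ} (ha : 0 ≤ a)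
    (han : a < n + 1) (hN : 0 < N) (haN : a ≤ 2 * N / 7) :
    ∃ C : ℝ, 0 < C ∧ ∀ (t₀ : ℝ) (m : Fin (N + 1) → ℤ), t₀ ≠ 0 →
      ‖FKer n t₀ m‖ ≤ C * |t₀| ^ (-a) := by
  have hpi := Real.pi_pos
  obtain ⟨A, hA, hosc⟩ := exists_norm_oscIntegral_le_rpow
  set μ := (volume : Measure ℝ).restrict (Set.Icc (-Real.pi) Real.pi) with hμ
  set B := ∫ x, |Real.sin x| ^ ((n : ℝ) - a) ∂μ with hB
  have hB0 : 0 ≤ B := integral_nonneg fun x => by positivity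
  refine ⟨A ^ N * B + 1, by positivity, fun t₀ m ht => ?_⟩
  have ht' : 0 < |t₀| := abs_pos.2 ht
  have hNr : (0 : ℝ) < N := by exact_mod_cast hN
  set c : ℝ → ℂ := fun x => ((|Real.sin x| ^ n : ℝ) : ℂ) *
    Complex.exp (Complex.I * (((m 0 : ℝ) * x + t₀ * Real.sin x * Real.sin x ^ 2 : ℝ) : ℂ)) with hc
  set p : ℝ → Fin N → ℝ → ℂ := fun x j y => Complex.exp (Complex.I *
    (((m j.succ : ℝ) * y + t₀ * Real.sin x * Real.sin y ^ 2 : ℝ) : ℂ)) with hp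
  have hcn : ∀ x, ‖c x‖ = |Real.sin x| ^ n := fun x => by
    rw [hc]
    simp only
    rw [norm_mul, mul_comm Complex.I, Complex.norm_exp_ofReal_mul_I, mul_one,
      Complex.norm_real, Real.norm_of_nonneg (by positivity)]
  have hpn : ∀ x j y, ‖p x j y‖ = 1 := fun x j y => by
    rw [hp]
    simp only
    rw [mul_comm Complex.I, Complex.norm_exp_ofReal_mul_I]
  have hF : FKer n t₀ m = ∫ z : ℝ × (Fin N → ℝ), c z.1 * ∏ j, p z.1 j (z.2 j)
      ∂(μ.prod (Measure.pi fun _ => μ)) := by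
    have hmp := (measurePreserving_piFinSuccAbove (fun _ : Fin (N + 1) => μ) 0).symm
    rw [FKer, restrict_cube_eq_pi, ← hμ, ← hmp.integral_comp']
    congr 1 with z
    rw [MeasurableEquiv.piFinSuccAbove_symm_apply, omegaInf, hc, hp]
    simp only [Fin.insertNthEquiv_zero, Fin.consEquiv_apply, Fin.sum_univ_succ, Fin.cons_zero,
      Fin.cons_succ]
    rw [← Complex.exp_sum, mul_assoc, mul_assoc, ← Complex.exp_add, ← Complex.exp_add]
    congr 2
    push_cast
    rw [← Finset.mul_sum, Finset.sum_add_distrib, ← Finset.mul_sum]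
    ring
  have hint : Integrable (fun z : ℝ × (Fin N → ℝ) => c z.1 * ∏ j, p z.1 j (z.2 j))
      (μ.prod (Measure.pi fun _ => μ)) := by
    have hcont : Continuous (fun z : ℝ × (Fin N → ℝ) => c z.1 * ∏ j, p z.1 j (z.2 j)) := by
      rw [hc, hp]; fun_prop
    refine Integrable.of_bound hcont.aestronglyMeasurable 1 (Filter.Eventually.of_forall fun z => ?_)
    rw [norm_mul, norm_prod, hcn]
    simp only [hpn, Finset.prod_const_one, mul_one]
    exact pow_le_one₀ (abs_nonneg _) (Real.abs_sin_le_one _)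
  have hprod : ∀ x, ∫ y : Fin N → ℝ, c x * ∏ j, p x j (y j) ∂(Measure.pi fun _ => μ) =
      c x * ∏ j : Fin N, oscIntegral (m j.succ) (t₀ * Real.sin x) := by
    intro x
    rw [integral_const_mul, integral_fintype_prod_eq_prod (𝕜 := ℂ) (p x)]
    congr 1
    refine Finset.prod_congr rfl fun j _ => ?_
    rw [hμ, integral_Icc_eq_integral_Ioc, ← intervalIntegral.integral_of_le (by linarith)]
    rfl
  rw [hF, integral_prod _ hint]
  simp_rw [hprod]
  refine (norm_integral_le_integral_norm _).trans ?_
  have hsint : Integrable (fun x => |Real.sin x| ^ ((n : ℝ) - a)) μ := by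
    have := intervalIntegrable_abs_sin_rpow (r := (n : ℝ) - a) (by linarith) (-Real.pi) Real.pi
    rwa [intervalIntegrable_iff_integrableOn_Icc_of_le (by linarith)] at this
  have hbound : ∀ᵐ x ∂μ, ‖c x * ∏ j : Fin N, oscIntegral (m j.succ) (t₀ * Real.sin x)‖ ≤
      A ^ N * |t₀| ^ (-a) * |Real.sin x| ^ ((n : ℝ) - a) := by
    filter_upwards [ae_restrict_of_ae ae_sin_ne_zero] with x hx
    have hs : 0 < |Real.sin x| := abs_pos.2 hx
    have h1 : ∀ j : Fin N, ‖oscIntegral (m j.succ) (t₀ * Real.sin x)‖ ≤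
        A * |t₀ * Real.sin x| ^ (-(a / N)) := fun j => by
      refine hosc _ _ _ (mul_ne_zero ht hx) (by positivity) ?_
      rw [div_le_iff₀ hNr]
      linarith
    have h2 : ∏ j : Fin N, ‖oscIntegral (m j.succ) (t₀ * Real.sin x)‖ ≤
        A ^ N * (|t₀| ^ (-a) * |Real.sin x| ^ (-a)) := by
      refine (Finset.prod_le_prod (fun j _ => norm_nonneg _) fun j _ => h1 j).trans_eq ?_
      rw [Finset.prod_const, Finset.card_univ, Fintype.card_fin, mul_pow, ← Real.rpow_natCast
        (|t₀ * Real.sin x| ^ (-(a / N))), ← Real.rpow_mul (abs_nonneg _), abs_mul,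
        Real.mul_rpow (abs_nonneg _) (abs_nonneg _), neg_mul, div_mul_cancel₀ _ hNr.ne']
    rw [norm_mul, norm_prod, hcn, sub_eq_add_neg, Real.rpow_add hs, Real.rpow_natCast]
    calc |Real.sin x| ^ n * ∏ j : Fin N, ‖oscIntegral (m j.succ) (t₀ * Real.sin x)‖
        ≤ |Real.sin x| ^ n * (A ^ N * (|t₀| ^ (-a) * |Real.sin x| ^ (-a))) := by gcongr
      _ = _ := by ring
  have h3 := integral_mono_of_nonneg (Filter.Eventually.of_forall fun x => norm_nonneg _)
    (hsint.const_mul (A ^ N * |t₀| ^ (-a))) hbound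
  rw [integral_const_mul, ← hB] at h3
  have h4 : 0 < |t₀| ^ (-a) := by positivity
  linarith

theorem rpow_neg_le_japanese {a : ℝ} (ha : 0 ≤ a) {t : ℝ} (ht : 1 ≤ |t|) :
    |t| ^ (-a) ≤ 2 ^ a * Real.sqrt (1 + t ^ 2) ^ (-a) := by
  have h1 : Real.sqrt (1 + t ^ 2) ≤ 2 * |t| := by
    rw [Real.sqrt_le_left (by positivity), mul_pow, sq_abs]
    nlinarith [sq_abs t]
  have h0 : 0 < Real.sqrt (1 + t ^ 2) := by positivity
  have h2 := Real.rpow_le_rpow_of_nonpos h0 h1 (neg_nonpos.2 ha)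
  rw [Real.mul_rpow (by norm_num) (abs_nonneg _), Real.rpow_neg (by norm_num)] at h2
  rwa [← inv_mul_le_iff₀ (by positivity)]

theorem one_le_japanese {a : ℝ} (ha : 0 ≤ a) {t : ℝ} (ht : |t| ≤ 1) :
    1 ≤ 2 ^ a * Real.sqrt (1 + t ^ 2) ^ (-a) := by
  have h1 : Real.sqrt (1 + t ^ 2) ≤ 2 := by
    rw [Real.sqrt_le_left (by norm_num)]
    nlinarith [sq_abs t, abs_nonneg t]
  have h0 : 0 < Real.sqrt (1 + t ^ 2) := by positivity
  have h2 := Real.rpow_le_rpow_of_nonpos h0 h1 (neg_nonpos.2 ha)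
  rw [Real.rpow_neg (by norm_num)] at h2
  rwa [← inv_le_iff_one_le_mul₀' (by positivity)]

/-- If `2n + 5 < d`, there is a constant `C` depending only on `d` and
`n`, and independent of `t₀`, such that the `ℓ⁴` norm of `𝔉^{Ker}(·,t₀)` decays like
`⟨t₀⟩^{−(2n/7 + 13/30)}`, where `⟨t₀⟩ = (1 + t₀²)^{1/2}`. -/
theorem l4_decay_FKer (d n : ℕ) [NeZero d] (hd : 2 ≤ d) (hn : 2 * n + 5 < d) :
    ∃ C : ℝ, 0 < C ∧
      ∀ t₀ : ℝ,
        Summable (fun m : Fin d → ℤ => ‖FKer (d := d) n t₀ m‖ ^ 4) ∧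
          (∑' m : Fin d → ℤ, ‖FKer (d := d) n t₀ m‖ ^ 4) ^ ((1 : ℝ) / 4) ≤
            C * Real.sqrt (1 + t₀ ^ 2) ^ (-(2 * (n : ℝ) / 7 + 13 / 30)) := by
  obtain ⟨N, rfl⟩ : ∃ N, d = N + 1 := ⟨d - 1, by omega⟩
  set b : ℝ := 2 * (n : ℝ) / 7 + 13 / 30 with hb
  have hb0 : 0 ≤ b := by positivity
  have hNn : (2 * n + 5 : ℝ) ≤ N := by exact_mod_cast (by omega : 2 * n + 5 ≤ N)
  have hn0 : (0 : ℝ) ≤ n := Nat.cast_nonneg n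
  obtain ⟨C₁, hC₁, hsup⟩ := exists_norm_FKer_le_rpow N n (a := 2 * b) (by positivity)
    (by linarith) (by omega) (by linarith)
  obtain ⟨D, hD, hl2⟩ := exists_tsum_norm_FKer_sq_le (N + 1) n
  set K : ℝ := (C₁ + Real.sqrt D) * 2 ^ (2 * b) with hK
  have hK0 : 0 < K := by positivity
  have hbound : ∀ (t₀ : ℝ) (m : Fin (N + 1) → ℤ),
      ‖FKer n t₀ m‖ ≤ K * Real.sqrt (1 + t₀ ^ 2) ^ (-(2 * b)) := by
    intro t₀ m
    have hsq : 0 ≤ Real.sqrt D := Real.sqrt_nonneg D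
    rw [hK, mul_assoc]
    rcases le_total |t₀| 1 with h | h
    · have h1 : ‖FKer n t₀ m‖ ≤ Real.sqrt D := by
        apply Real.le_sqrt_of_sq_le
        exact ((hl2 t₀).1.le_tsum m fun _ _ => by positivity).trans (hl2 t₀).2
      have h2 := one_le_japanese (a := 2 * b) (by positivity) h
      nlinarith
    · have h1 := hsup t₀ m (abs_pos.1 (by linarith))
      have h2 := rpow_neg_le_japanese (a := 2 * b) (by positivity) h
      have h3 : 0 ≤ |t₀| ^ (-(2 * b)) := by positivity
      nlinarith
  refine ⟨(K ^ 2 * D) ^ ((1 : ℝ) / 4), by positivity, fun t₀ => ?_⟩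
  obtain ⟨hs, hle⟩ := hl2 t₀
  set J := Real.sqrt (1 + t₀ ^ 2) with hJ
  have hJ0 : 0 < J := by positivity
  have hpt : ∀ m : Fin (N + 1) → ℤ, ‖FKer n t₀ m‖ ^ 4 ≤
      (K * J ^ (-(2 * b))) ^ 2 * ‖FKer n t₀ m‖ ^ 2 := by
    intro m
    have h1 := pow_le_pow_left₀ (norm_nonneg _) (hbound t₀ m) 2
    calc ‖FKer n t₀ m‖ ^ 4 = ‖FKer n t₀ m‖ ^ 2 * ‖FKer n t₀ m‖ ^ 2 := by ring
      _ ≤ _ := by gcongr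
  have hs4 := Summable.of_nonneg_of_le (fun m => by positivity) hpt (hs.mul_left _)
  refine ⟨hs4, ?_⟩
  have htsum : ∑' m : Fin (N + 1) → ℤ, ‖FKer n t₀ m‖ ^ 4 ≤ (K ^ 2 * D) * (J ^ (-b)) ^ 4 := by
    refine (hs4.tsum_le_tsum hpt (hs.mul_left _)).trans ?_
    rw [tsum_mul_left]
    have h1 : J ^ (-(2 * b)) = (J ^ (-b)) ^ 2 := by
      rw [← Real.rpow_natCast, ← Real.rpow_mul hJ0.le]
      congr 1
      push_cast
      ring
    rw [h1]
    calc (K * (J ^ (-b)) ^ 2) ^ 2 * ∑' m : Fin (N + 1) → ℤ, ‖FKer n t₀ m‖ ^ 2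
        ≤ (K * (J ^ (-b)) ^ 2) ^ 2 * D := by gcongr
      _ = _ := by ring
  refine (Real.rpow_le_rpow (tsum_nonneg fun m => by positivity) htsum (by norm_num)).trans_eq ?_
  rw [Real.mul_rpow (by positivity) (by positivity), one_div]
  congr 1
  exact Real.pow_rpow_inv_natCast (by positivity) (by norm_num)
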